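/- arXiv:2601.17872 — 5 statements merged into one kernel-verified Lean document; each statement's English description precedes it below -/
import Mathlib

section
/- Let n ≥ 3 be an integer and let δ > 0. Then there exists a constant ĉ > 0 such that, as λ → ∞, (λ^{n−2} / log λ) · ∫_{{x' ∈ ℝ^{n−1} : ‖x'‖ < δ}} λⁿ |x'₁|^{n−1} (1 + λ²‖x'‖²)^{−(n−1)} dx' converges to ĉ. -/
open MeasureTheory Filter

/-- Integration in polar coordinates of the product of a positively homogeneous function
and a radial function. -/
lemma integral_homogeneous_mul_radial {E : Type*} [NormedAddCommGroup E] [NormedSpace ℝ E]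
    [MeasurableSpace E] [BorelSpace E] [FiniteDimensional ℝ E] [Nontrivial E]
    (μ : Measure E) [μ.IsAddHaarMeasure] (d : ℕ) (p : E → ℝ)
    (hp : ∀ (r : ℝ) (x : E), 0 < r → p (r • x) = r ^ d * p x) (f : ℝ → ℝ) :
    ∫ x, p x * f ‖x‖ ∂μ = (∫ ω : Metric.sphere (0 : E) 1, p ω ∂μ.toSphere) *
      ∫ r in Set.Ioi (0 : ℝ), r ^ (Module.finrank ℝ E - 1) * (r ^ d * f r) := by
  calc
    ∫ x, p x * f ‖x‖ ∂μ
      = ∫ x : ({(0)}ᶜ : Set E), p x.1 * f ‖x.1‖ ∂(μ.comap (↑)) := by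
      rw [integral_subtype_comap (measurableSet_singleton _).compl fun x ↦ p x * f ‖x‖,
        restrict_compl_singleton]
    _ = ∫ z : Metric.sphere (0 : E) 1 × Set.Ioi (0 : ℝ), p z.1 * (z.2.1 ^ d * f z.2)
          ∂μ.toSphere.prod (.volumeIoiPow (Module.finrank ℝ E - 1)) := by
      rw [← μ.measurePreserving_homeomorphUnitSphereProd.integral_comp
        (Homeomorph.measurableEmbedding _)]
      refine integral_congr_ae (.of_forall fun x ↦ ?_)
      have hx : 0 < ‖x.1‖ := norm_pos_iff.2 x.2
      have h := hp ‖x.1‖ (‖x.1‖⁻¹ • x.1) hx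
      rw [smul_inv_smul₀ hx.ne'] at h
      simp only [homeomorphUnitSphereProd_apply_snd_coe, homeomorphUnitSphereProd_apply_fst_coe]
      rw [h]
      ring
    _ = (∫ ω : Metric.sphere (0 : E) 1, p ω ∂μ.toSphere) *
          ∫ r : Set.Ioi (0 : ℝ), r.1 ^ d * f r
            ∂.volumeIoiPow (Module.finrank ℝ E - 1) :=
      integral_prod_mul (fun ω : Metric.sphere (0 : E) 1 ↦ p ω)
        (fun r : Set.Ioi (0 : ℝ) ↦ r.1 ^ d * f r)
    _ = _ := by
      congr 1
      simp only [Measure.volumeIoiPow, ENNReal.ofReal]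
      rw [integral_withDensity_eq_integral_smul,
        integral_subtype_comap measurableSet_Ioi
          fun a ↦ Real.toNNReal (a ^ (Module.finrank ℝ E - 1)) • (a ^ d * f a),
        setIntegral_congr_fun measurableSet_Ioi fun x hx ↦ ?_]
      · rw [NNReal.smul_def, Real.coe_toNNReal _ (pow_nonneg hx.out.le _), smul_eq_mul]
      · exact (measurable_subtype_coe.pow_const _).real_toNNReal

lemma integral_mul_div_one_add_sq (a δ : ℝ) :
    ∫ r in (0 : ℝ)..δ, a ^ 2 * r / (1 + a ^ 2 * r ^ 2) =
      Real.log (1 + a ^ 2 * δ ^ 2) / 2 := by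
  have hw : ∀ r : ℝ, 1 + a ^ 2 * r ^ 2 ≠ 0 := fun r ↦ by positivity
  rw [intervalIntegral.integral_eq_sub_of_hasDerivAt
    (f := fun r ↦ Real.log (1 + a ^ 2 * r ^ 2) / 2)]
  · simp
  · intro r _
    have h := ((((hasDerivAt_pow 2 r).const_mul (a ^ 2)).const_add 1).log (hw r)).div_const 2
    refine h.congr_deriv ?_
    have := hw r
    push_cast
    field_simp
  · exact (Continuous.div (by fun_prop) (by fun_prop) hw).intervalIntegrable _ _

lemma integral_mul_div_one_add_sq_sq (a δ : ℝ) :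
    ∫ r in (0 : ℝ)..δ, a ^ 2 * r / (1 + a ^ 2 * r ^ 2) ^ 2 =
      (1 - (1 + a ^ 2 * δ ^ 2)⁻¹) / 2 := by
  have hw : ∀ r : ℝ, 1 + a ^ 2 * r ^ 2 ≠ 0 := fun r ↦ by positivity
  rw [intervalIntegral.integral_eq_sub_of_hasDerivAt
    (f := fun r ↦ -(1 + a ^ 2 * r ^ 2)⁻¹ / 2)]
  · simp
    ring
  · intro r _
    have h := ((((hasDerivAt_pow 2 r).const_mul (a ^ 2)).const_add 1).inv (hw r)).neg.div_const 2
    refine h.congr_deriv ?_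
    have := hw r
    push_cast
    field_simp
  · exact (Continuous.div (by fun_prop) (by fun_prop)
      fun r ↦ pow_ne_zero 2 (hw r)).intervalIntegrable _ _

lemma tendsto_log_one_add_sq_div_log {δ : ℝ} (hδ : 0 < δ) :
    Tendsto (fun a : ℝ ↦ Real.log (1 + a ^ 2 * δ ^ 2) / 2 / Real.log a) atTop (nhds 1) := by
  have h0 : Tendsto (fun a : ℝ ↦ Real.log ((a ^ 2)⁻¹ + δ ^ 2)) atTop
      (nhds (Real.log (0 + δ ^ 2))) :=
    ((tendsto_inv_atTop_zero.comp (tendsto_pow_atTop two_ne_zero)).add_const _).log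
      (by positivity)
  have h1 := ((h0.div_atTop Real.tendsto_log_atTop).div_const 2).const_add 1
  rw [zero_div, add_zero] at h1
  refine h1.congr' ?_
  filter_upwards [eventually_gt_atTop 1] with a ha
  have hl : 0 < Real.log a := Real.log_pos ha
  have ha0 : 0 < a := by linarith
  have : 1 + a ^ 2 * δ ^ 2 = a ^ 2 * ((a ^ 2)⁻¹ + δ ^ 2) := by field_simp
  rw [this, Real.log_mul (by positivity) (by positivity), Real.log_pow]
  field_simp
  push_cast
  ring

/-- The radial integral of the rescaled profile grows like `log a`. -/
lemma tendsto_radial_integral_div_log (k : ℕ) {δ : ℝ} (hδ : 0 < δ) :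
    Tendsto (fun a : ℝ ↦ (∫ r in (0 : ℝ)..δ,
        a ^ 2 * r / (1 + a ^ 2 * r ^ 2) * (a ^ 2 * r ^ 2 / (1 + a ^ 2 * r ^ 2)) ^ k) /
          Real.log a) atTop (nhds 1) := by
  have hw : ∀ a r : ℝ, 0 < 1 + a ^ 2 * r ^ 2 := fun a r ↦ by positivity
  have hc1 : ∀ a : ℝ, Continuous fun r : ℝ ↦ a ^ 2 * r / (1 + a ^ 2 * r ^ 2) := fun a ↦
    Continuous.div (by fun_prop) (by fun_prop) fun r ↦ (hw a r).ne'
  have hc2 : ∀ a : ℝ, Continuous fun r : ℝ ↦ a ^ 2 * r / (1 + a ^ 2 * r ^ 2) ^ 2 := fun a ↦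
    Continuous.div (by fun_prop) (by fun_prop) fun r ↦ pow_ne_zero 2 (hw a r).ne'
  have hc3 : ∀ a : ℝ, Continuous fun r : ℝ ↦
      a ^ 2 * r / (1 + a ^ 2 * r ^ 2) * (a ^ 2 * r ^ 2 / (1 + a ^ 2 * r ^ 2)) ^ k := fun a ↦
    (hc1 a).mul (Continuous.pow
      (Continuous.div (by fun_prop) (by fun_prop) fun r ↦ (hw a r).ne') k)
  have hlow := (tendsto_log_one_add_sq_div_log hδ).sub
    ((tendsto_const_nhds (x := (k : ℝ) / 2)).div_atTop Real.tendsto_log_atTop)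
  rw [sub_zero] at hlow
  refine tendsto_of_tendsto_of_tendsto_of_le_of_le' hlow (tendsto_log_one_add_sq_div_log hδ) ?_ ?_
  · filter_upwards [eventually_gt_atTop 1] with a ha
    rw [← sub_div]
    refine div_le_div_of_nonneg_right ?_ (Real.log_pos ha).le
    calc
      Real.log (1 + a ^ 2 * δ ^ 2) / 2 - k / 2
        ≤ Real.log (1 + a ^ 2 * δ ^ 2) / 2 - k * ((1 - (1 + a ^ 2 * δ ^ 2)⁻¹) / 2) := by
        have : 0 ≤ (k : ℝ) * (1 + a ^ 2 * δ ^ 2)⁻¹ := by positivity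
        linarith
      _ = ∫ r in (0 : ℝ)..δ, (a ^ 2 * r / (1 + a ^ 2 * r ^ 2) -
            k * (a ^ 2 * r / (1 + a ^ 2 * r ^ 2) ^ 2)) := by
        rw [intervalIntegral.integral_sub ((hc1 a).intervalIntegrable _ _)
          (((hc2 a).const_mul _).intervalIntegrable _ _), intervalIntegral.integral_const_mul,
          integral_mul_div_one_add_sq, integral_mul_div_one_add_sq_sq]
      _ ≤ _ := by
        refine intervalIntegral.integral_mono_on hδ.le
          (((hc1 a).sub ((hc2 a).const_mul _)).intervalIntegrable _ _)
          ((hc3 a).intervalIntegrable _ _) fun r hr ↦ ?_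
        have hr0 : 0 ≤ r := hr.1
        have ht : 0 ≤ a ^ 2 * r ^ 2 / (1 + a ^ 2 * r ^ 2) := by positivity
        have hb := one_add_mul_sub_le_pow (neg_one_lt_zero.le.trans ht) k
        refine le_trans (le_of_eq ?_) (mul_le_mul_of_nonneg_left hb (by positivity))
        have := (hw a r).ne'
        field_simp
        ring
  · filter_upwards [eventually_gt_atTop 1] with a ha
    refine div_le_div_of_nonneg_right ?_ (Real.log_pos ha).le
    rw [← integral_mul_div_one_add_sq]
    refine intervalIntegral.integral_mono_on hδ.le ((hc3 a).intervalIntegrable _ _)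
      ((hc1 a).intervalIntegrable _ _) fun r hr ↦ ?_
    have hr0 : 0 ≤ r := hr.1
    refine mul_le_of_le_one_right (by positivity) (pow_le_one₀ (by positivity) ?_)
    rw [div_le_one (hw a r)]
    linarith

/-- Logarithmic rescaled limit underlying the expansion (2.144) for β = n - 1. -/
theorem rescaled_log_limit (n : ℕ) (hn : 3 ≤ n) (δ : ℝ) (hδ : 0 < δ) :
    ∃ chat : ℝ, 0 < chat ∧
      Tendsto (fun lam : ℝ => lam ^ ((n : ℝ) - 2) / Real.log lam *
          ∫ x' in {x' : EuclideanSpace ℝ (Fin (n - 1)) | ‖x'‖ < δ},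
            lam ^ (n : ℝ) * |x' ⟨0, by omega⟩| ^ ((n : ℝ) - 1) *
              (1 + lam ^ 2 * ‖x'‖ ^ 2) ^ (-((n : ℝ) - 1)))
        atTop (nhds chat) := by
  obtain ⟨k, rfl⟩ : ∃ k, n = k + 2 := ⟨n - 2, by omega⟩
  have e1 : ((k + 2 : ℕ) : ℝ) - 1 = ((k + 1 : ℕ) : ℝ) := by push_cast; ring
  have e2 : ((k + 2 : ℕ) : ℝ) - 2 = (k : ℝ) := by push_cast; ring
  simp only [e1, e2, Real.rpow_natCast]
  change ∃ chat : ℝ, 0 < chat ∧ Tendsto (fun a : ℝ ↦ a ^ k / Real.log a *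
    ∫ x in {x : EuclideanSpace ℝ (Fin (k + 1)) | ‖x‖ < δ},
      a ^ (k + 2) * |x 0| ^ (k + 1) * (1 + a ^ 2 * ‖x‖ ^ 2) ^ (-((k + 1 : ℕ) : ℝ)))
    atTop (nhds chat)
  set μ : Measure (EuclideanSpace ℝ (Fin (k + 1))) := volume
  set p : EuclideanSpace ℝ (Fin (k + 1)) → ℝ := fun x ↦ |x 0| ^ (k + 1)
  have hpc : Continuous fun ω : Metric.sphere (0 : EuclideanSpace ℝ (Fin (k + 1))) 1 ↦ p ω := by
    fun_prop
  have hpos : 0 < ∫ ω : Metric.sphere (0 : EuclideanSpace ℝ (Fin (k + 1))) 1, p ω ∂μ.toSphere :=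
    hpc.integral_pos_of_hasCompactSupport_nonneg_nonzero
      (x := ⟨EuclideanSpace.single 0 1, by simp⟩)
      (HasCompactSupport.of_compactSpace _) (fun ω ↦ by positivity) (by simp [p])
  refine ⟨_, hpos, ?_⟩
  have hlim := (tendsto_radial_integral_div_log k hδ).const_mul
    (∫ ω : Metric.sphere (0 : EuclideanSpace ℝ (Fin (k + 1))) 1, p ω ∂μ.toSphere)
  rw [mul_one] at hlim
  refine hlim.congr fun a ↦ ?_
  have hw : ∀ r : ℝ, 0 < 1 + a ^ 2 * r ^ 2 := fun r ↦ by positivity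
  set f : ℝ → ℝ := (Set.Iio δ).indicator
    fun r ↦ a ^ (k + 2) * (1 + a ^ 2 * r ^ 2) ^ (-((k + 1 : ℕ) : ℝ)) with hf
  have hset : MeasurableSet {x : EuclideanSpace ℝ (Fin (k + 1)) | ‖x‖ < δ} :=
    measurableSet_lt measurable_norm measurable_const
  have hball : ∫ x in {x : EuclideanSpace ℝ (Fin (k + 1)) | ‖x‖ < δ},
      a ^ (k + 2) * |x 0| ^ (k + 1) * (1 + a ^ 2 * ‖x‖ ^ 2) ^ (-((k + 1 : ℕ) : ℝ)) =
        ∫ x, p x * f ‖x‖ ∂μ := by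
    rw [← integral_indicator hset]
    refine integral_congr_ae (.of_forall fun x ↦ ?_)
    by_cases hx : ‖x‖ < δ
    · simp only [hf, p, Set.indicator, Set.mem_ofPred_eq, Set.mem_Iio, hx, if_true]
      ring
    · simp [hf, Set.indicator, hx]
  have hrad : a ^ k * ∫ r in Set.Ioi (0 : ℝ), r ^ k * (r ^ (k + 1) * f r) =
      ∫ r in (0 : ℝ)..δ,
        a ^ 2 * r / (1 + a ^ 2 * r ^ 2) * (a ^ 2 * r ^ 2 / (1 + a ^ 2 * r ^ 2)) ^ k := by
    rw [intervalIntegral.integral_of_le hδ.le, integral_Ioc_eq_integral_Ioo,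
      ← Set.Ioi_inter_Iio, ← setIntegral_indicator measurableSet_Iio, ← integral_const_mul]
    refine integral_congr_ae (.of_forall fun r ↦ ?_)
    by_cases hr : r < δ
    · simp only [hf, Set.indicator, Set.mem_Iio, hr, if_true]
      rw [Real.rpow_neg (hw r).le, Real.rpow_natCast, div_pow]
      have := (hw r).ne'
      field_simp
      ring
    · simp [hf, Set.indicator, hr]
  have hpolar := integral_homogeneous_mul_radial μ (k + 1) p (fun r x hr ↦ by
    simp [p, abs_mul, mul_pow, abs_of_pos hr]) f
  rw [finrank_euclideanSpace_fin, Nat.add_sub_cancel] at hpolar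
  rw [hball, hpolar, ← hrad]
  ring
end

section
/- Let n ≥ 3 be an integer and let μ be a real number with 0 < μ < n. Then there exists a constant c > 0 such that for every x ∈ ℝⁿ, ∫_{ℝⁿ} ‖x − y‖^{−μ} (1 + ‖y‖²)^{−(2n−μ)/2} dy = c · (1 + ‖x‖²)^{−μ/2}. -/
open MeasureTheory

section Inversion

open EuclideanGeometry Module

variable {E : Type*} [NormedAddCommGroup E] [InnerProductSpace ℝ E]

/-- The inversion of center `a` and radius `√(1 + ‖a‖ ^ 2)` is conformal for the spherical
metric. -/
theorem one_add_norm_sq_inversion {a y : E} {R : ℝ} (hR : R ^ 2 = 1 + ‖a‖ ^ 2) (hy : y ≠ a) :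
    1 + ‖inversion a R y‖ ^ 2 = (R / dist y a) ^ 2 * (1 + ‖y‖ ^ 2) := by
  have hd : ‖y - a‖ ≠ 0 := norm_ne_zero_iff.2 (sub_ne_zero.2 hy)
  have hya : ‖y‖ ^ 2 = ‖y - a‖ ^ 2 + 2 * inner ℝ (y - a) a + ‖a‖ ^ 2 := by
    rw [← norm_add_sq_real, sub_add_cancel]
  simp only [inversion, vsub_eq_sub, vadd_eq_add]
  rw [norm_add_sq_real, norm_smul, inner_smul_left, dist_eq_norm, hya, mul_pow, Real.norm_eq_abs,
    sq_abs]
  simp only [div_pow, hR, conj_trivial]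
  field_simp
  ring

/-- Change of variables under an inversion. -/
theorem integral_eq_integral_inversion [FiniteDimensional ℝ E] [Nontrivial E]
    [MeasurableSpace E] [BorelSpace E] (a : E) {R : ℝ} (hR : R ≠ 0) (g : E → ℝ) :
    ∫ y, g y = ∫ y, ((R / dist y a) ^ 2) ^ finrank ℝ E * g (inversion a R y) := by
  have himg : inversion a R '' {a}ᶜ = {a}ᶜ := by
    rw [Set.image_compl_eq (inversion_bijective a hR), Set.image_singleton, inversion_self]
  have h := integral_image_eq_integral_abs_det_fderiv_smul volume
    (measurableSet_singleton a).compl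
    (fun y hy ↦ (hasFDerivAt_inversion (R := R) hy).hasFDerivWithinAt)
    (inversion_injective a hR).injOn g
  rw [himg, restrict_compl_singleton] at h
  rw [h]
  refine integral_congr_ae (Filter.Eventually.of_forall fun y ↦ ?_)
  have hdet : |((ℝ ∙ (y - a))ᗮ.reflection : E →L[ℝ] E).det| = 1 := by
    have : ((ℝ ∙ (y - a))ᗮ.reflection : E →L[ℝ] E).det = _ := (ℝ ∙ (y - a))ᗮ.det_reflection
    rw [this]
    simp
  simp only [ContinuousLinearMap.det] at hdet ⊢
  rw [ContinuousLinearMap.toLinearMap_smul, LinearMap.det_smul, abs_mul, hdet, mul_one, smul_eq_mul,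
    abs_of_nonneg (by positivity)]

/-- Every nonzero point is the image of the origin under a spherically conformal inversion. -/
theorem inversion_neg_inv_norm_sq_smul_zero {x a : E} {R : ℝ} (hx : x ≠ 0)
    (ha : a = -((‖x‖ ^ 2)⁻¹ • x)) (hR : R ^ 2 = 1 + ‖a‖ ^ 2) : inversion a R 0 = x := by
  have hx' : ‖x‖ ≠ 0 := norm_ne_zero_iff.2 hx
  have hna : ‖a‖ = ‖x‖⁻¹ := by
    rw [ha, norm_neg, norm_smul, norm_inv, norm_pow, norm_norm]
    field_simp
  simp only [inversion, vsub_eq_sub, vadd_eq_add, zero_sub, dist_zero_left, div_pow, hR, hna]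
  rw [ha, neg_neg, smul_smul, ← sub_eq_add_neg, ← sub_smul]
  convert one_smul ℝ x using 2
  field_simp
  ring

end Inversion

/-- The Riesz kernel against the critical bubble transforms conformally under an inversion. -/
theorem riesz_bubble_inversion {m s R A d t b : ℝ} {n : ℕ} (hb : b = (2 * n - m) / 2)
    (hR : 0 < R) (hA : 0 < A) (hd : 0 < d) (ht : 0 ≤ t) (hs : 0 < s) :
    ((R / d) ^ 2) ^ n * ((R ^ 2 / (A * d) * t) ^ (-m) * ((R / d) ^ 2 * s) ^ (-b)) =
      ((R / A) ^ 2) ^ (-(m / 2)) * (t ^ (-m) * s ^ (-b)) := by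
  have h1 : R ^ 2 / (A * d) = (R / A) * (R / d) := by field_simp
  have hRA : 0 < R / A := by positivity
  have hRd : 0 < R / d := by positivity
  rw [h1, Real.mul_rpow (by positivity) ht, Real.mul_rpow hRA.le hRd.le,
    Real.mul_rpow (by positivity) hs.le]
  generalize R / A = p at *
  generalize R / d = q at *
  have h2 : (p ^ 2) ^ (-(m / 2)) = p ^ (-m) := by
    rw [← Real.rpow_natCast, ← Real.rpow_mul hRA.le]; congr 1; push_cast; ring
  have h3 : (q ^ 2) ^ n * (q ^ (-m) * (q ^ 2) ^ (-b)) = 1 := by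
    rw [← pow_mul, ← Real.rpow_natCast, ← Real.rpow_natCast q 2, ← Real.rpow_mul hRd.le,
      ← Real.rpow_add hRd, ← Real.rpow_add hRd, ← Real.rpow_zero q, hb]
    congr 1; push_cast; ring
  rw [h2]
  linear_combination p ^ (-m) * t ^ (-m) * s ^ (-b) * h3

theorem integrable_norm_rpow_mul_one_add_norm_sq_rpow {n : ℕ} (hn : 0 < n) {m b : ℝ}
    (hm : m < n) (hb : n < m + 2 * b) :
    Integrable fun y : EuclideanSpace ℝ (Fin n) ↦ ‖y‖ ^ (-m) * (1 + ‖y‖ ^ 2) ^ (-b) := by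
  have : Nonempty (Fin n) := ⟨⟨0, hn⟩⟩
  rw [integrable_fun_norm_addHaar volume (f := fun r : ℝ ↦ r ^ (-m) * (1 + r ^ 2) ^ (-b)),
    finrank_euclideanSpace_fin]
  have hpow {r : ℝ} (hr : 0 < r) : r ^ (n - 1) * r ^ (-m) = r ^ ((n : ℝ) - 1 - m) := by
    rw [← Real.rpow_natCast, ← Real.rpow_add hr, Nat.cast_sub hn]
    congr 1; push_cast; ring
  have hmeas : Measurable fun r : ℝ ↦ r ^ (n - 1) • (r ^ (-m) * (1 + r ^ 2) ^ (-b)) := by fun_prop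
  rw [← Set.Ioc_union_Ioi_eq_Ioi zero_le_one]
  refine IntegrableOn.union ?_ ?_
  · have h := (intervalIntegral.intervalIntegrable_rpow' (a := 0) (b := 1)
      (r := (n : ℝ) - 1 - m) (by linarith)).1
    refine Integrable.mono' h hmeas.aestronglyMeasurable ?_
    filter_upwards [ae_restrict_mem measurableSet_Ioc] with r hr
    have hr0 : 0 < r := hr.1
    rw [smul_eq_mul, Real.norm_of_nonneg (by positivity), ← mul_assoc, hpow hr0]
    exact mul_le_of_le_one_right (by positivity)
      (Real.rpow_le_one_of_one_le_of_nonpos (by nlinarith) (by linarith))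
  · have h := integrableOn_Ioi_rpow_of_lt (a := (n : ℝ) - 1 - m - 2 * b) (by linarith) one_pos
    refine Integrable.mono' h hmeas.aestronglyMeasurable ?_
    filter_upwards [ae_restrict_mem measurableSet_Ioi] with r hr
    have hr0 : 0 < r := one_pos.trans hr
    rw [smul_eq_mul, Real.norm_of_nonneg (by positivity), ← mul_assoc, hpow hr0,
      sub_eq_add_neg _ (2 * b), Real.rpow_add hr0]
    gcongr
    calc (1 + r ^ 2) ^ (-b) ≤ (r ^ 2) ^ (-b) :=
          Real.rpow_le_rpow_of_nonpos (by positivity) (by linarith) (by linarith)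
      _ = r ^ (-(2 * b)) := by
          rw [← Real.rpow_natCast, ← Real.rpow_mul hr0.le]; congr 1; push_cast; ring

/-- Identity (3.28): the Riesz potential of the critical power of the standard bubble is a
constant multiple of the complementary power of the bubble. -/
theorem riesz_potential_of_bubble (n : ℕ) (hn : 3 ≤ n) (μ : ℝ) (hμ0 : 0 < μ)
    (hμn : μ < n) :
    ∃ c : ℝ, 0 < c ∧ ∀ x : EuclideanSpace ℝ (Fin n),
      ∫ y : EuclideanSpace ℝ (Fin n),
          ‖x - y‖ ^ (-μ) * (1 + ‖y‖ ^ 2) ^ (-((2 * n - μ) / 2)) =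
        c * (1 + ‖x‖ ^ 2) ^ (-(μ / 2)) := by
  have : Nonempty (Fin n) := ⟨⟨0, by omega⟩⟩
  refine ⟨∫ y : EuclideanSpace ℝ (Fin n), ‖y‖ ^ (-μ) * (1 + ‖y‖ ^ 2) ^ (-((2 * n - μ) / 2)),
    ?_, fun x ↦ ?_⟩
  · rw [integral_pos_iff_support_of_nonneg (fun y ↦ by positivity)
      (integrable_norm_rpow_mul_one_add_norm_sq_rpow (by omega) hμn (by linarith))]
    have hsub : ({0}ᶜ : Set (EuclideanSpace ℝ (Fin n))) ⊆ Function.support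
        fun y ↦ ‖y‖ ^ (-μ) * (1 + ‖y‖ ^ 2) ^ (-((2 * n - μ) / 2)) := by
      intro y hy
      have : 0 < ‖y‖ := norm_pos_iff.2 hy
      exact ne_of_gt (by positivity)
    refine lt_of_lt_of_le ?_ (measure_mono hsub)
    exact isOpen_compl_singleton.measure_pos volume (Set.nonempty_compl_of_nontrivial 0)
  rcases eq_or_ne x 0 with rfl | hx
  · simp
  obtain ⟨a, ha⟩ : ∃ a, a = -((‖x‖ ^ 2)⁻¹ • x) := ⟨_, rfl⟩
  obtain ⟨R, hR⟩ : ∃ R, R = √(1 + ‖a‖ ^ 2) := ⟨_, rfl⟩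
  have hR0 : 0 < R := by rw [hR]; positivity
  have hR2 : R ^ 2 = 1 + ‖a‖ ^ 2 := by rw [hR, Real.sq_sqrt (by positivity)]
  have hinv := inversion_neg_inv_norm_sq_smul_zero hx ha hR2
  have ha0 : 0 ≠ a := by
    rw [ha, ne_comm]
    simp [hx]
  have hx1 : 1 + ‖x‖ ^ 2 = (R / ‖a‖) ^ 2 := by
    rw [← hinv, one_add_norm_sq_inversion hR2 ha0]
    simp
  rw [integral_eq_integral_inversion a hR0.ne', finrank_euclideanSpace_fin, ← integral_mul_const]
  refine integral_congr_ae ?_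
  filter_upwards [compl_mem_ae_iff.2 (measure_singleton (μ := volume) a)] with y hy
  have hya : y ≠ a := hy
  have hdist : ‖x - EuclideanGeometry.inversion a R y‖ = R ^ 2 / (‖a‖ * dist y a) * ‖y‖ := by
    rw [← dist_eq_norm]
    nth_rw 1 [← hinv]
    rw [EuclideanGeometry.dist_inversion_inversion ha0 hya]
    simp
  rw [hdist, one_add_norm_sq_inversion hR2 hya, hx1, mul_comm (_ * _) (((R / ‖a‖) ^ 2) ^ _)]
  exact riesz_bubble_inversion rfl hR0 (norm_pos_iff.2 ha0.symm) (dist_pos.2 hya) (norm_nonneg y)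
    (by positivity)
end

section
/- Let n ≥ 3 be an integer, let μ be a real number with 0 < μ < n, and let ρ > 0. There exists a constant C > 0 such that for every λ ≥ 1 with λρ ≥ 1, the double integral ∫_{{x ∈ ℝⁿ : ‖x‖ > ρ/2}} ∫_{ℝⁿ} ‖x − y‖^{−μ} · λ^{(2n−μ)/2} (1 + λ²‖y‖²)^{−(2n−μ)/2} · λ^{(2n−μ)/2} (1 + λ²‖x‖²)^{−(2n−μ)/2} dy dx is at most C · λ^{−(2n−μ)/2}. -/
open MeasureTheory

lemma rpow_mul_one_add_sq_rpow_neg_le_decay {a t r : ℝ} (ha : 0 ≤ a) (ht : 0 < t) (hr : 0 < r) :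
    t ^ a * (1 + t ^ 2 * r ^ 2) ^ (-a) ≤ t ^ (-a) * r ^ (-(2 * a)) := by
  have h1 : (1 + t ^ 2 * r ^ 2) ^ (-a) ≤ (t ^ 2 * r ^ 2) ^ (-a) :=
    Real.rpow_le_rpow_of_nonpos (by positivity) (by linarith) (by linarith)
  calc t ^ a * (1 + t ^ 2 * r ^ 2) ^ (-a)
      ≤ t ^ a * (t ^ 2 * r ^ 2) ^ (-a) := by gcongr
    _ = t ^ (-a) * r ^ (-(2 * a)) := by
      rw [Real.mul_rpow (by positivity) (by positivity), ← Real.rpow_natCast_mul ht.le,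
        ← Real.rpow_natCast_mul hr.le, ← mul_assoc, ← Real.rpow_add ht]
      push_cast
      ring_nf

lemma rpow_mul_one_add_sq_rpow_neg_le {a t r : ℝ} (ha : 0 ≤ a) (ht : 0 < t) (hr : 0 < r) :
    t ^ a * (1 + t ^ 2 * r ^ 2) ^ (-a) ≤ r ^ (-a) := by
  have h1 : (1 + t ^ 2 * r ^ 2) ^ (-a) ≤ (t * r) ^ (-a) :=
    Real.rpow_le_rpow_of_nonpos (by positivity) (by nlinarith [sq_nonneg (t * r - 1)])
      (by linarith)
  calc t ^ a * (1 + t ^ 2 * r ^ 2) ^ (-a)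
      ≤ t ^ a * (t * r) ^ (-a) := by gcongr
    _ = r ^ (-a) := by
      rw [Real.mul_rpow ht.le hr.le, ← mul_assoc, ← Real.rpow_add ht]
      simp

section

variable {E : Type*} [NormedAddCommGroup E] [NormedSpace ℝ E] [FiniteDimensional ℝ E]
  [MeasurableSpace E] [BorelSpace E] (ν : Measure E) [ν.IsAddHaarMeasure]

lemma setLIntegral_ball_norm_rpow_neg_lt_top (hd : 1 ≤ Module.finrank ℝ E) {s : ℝ}
    (hs : s < Module.finrank ℝ E) (R : ℝ) :
    ∫⁻ x in Metric.ball (0 : E) R, ENNReal.ofReal (‖x‖ ^ (-s)) ∂ν < ⊤ := by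
  refine Integrable.lintegral_lt_top (f := fun x : E ↦ ‖x‖ ^ (-s)) ?_
  refine integrableOn_ball_of_norm_le_rpow hd (C := 1) hs (Filter.Eventually.of_forall fun x ↦ ?_)
    (Measurable.aestronglyMeasurable (by fun_prop))
  rw [Real.norm_of_nonneg (by positivity), one_mul]

lemma setLIntegral_norm_gt_norm_rpow_neg_lt_top {s R : ℝ} (hR : 0 < R)
    (hs : Module.finrank ℝ E < s) :
    ∫⁻ x in {x : E | R < ‖x‖}, ENNReal.ofReal (‖x‖ ^ (-s)) ∂ν < ⊤ := by
  have hs0 : 0 < s := (Nat.cast_nonneg _).trans_lt hs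
  have hc : 0 < R / (1 + R) := by positivity
  have hle : ∀ x ∈ {x : E | R < ‖x‖}, ENNReal.ofReal (‖x‖ ^ (-s)) ≤
      ENNReal.ofReal ((R / (1 + R)) ^ (-s)) * ENNReal.ofReal ((1 + ‖x‖) ^ (-s)) := by
    intro x hx
    have hx : R < ‖x‖ := hx
    rw [← ENNReal.ofReal_mul (by positivity), ← Real.mul_rpow hc.le (by positivity)]
    refine ENNReal.ofReal_le_ofReal
      (Real.rpow_le_rpow_of_nonpos (by positivity) ?_ (by linarith))
    rw [div_mul_eq_mul_div, div_le_iff₀ (by positivity)]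
    nlinarith
  calc ∫⁻ x in {x : E | R < ‖x‖}, ENNReal.ofReal (‖x‖ ^ (-s)) ∂ν
      ≤ ∫⁻ x in {x : E | R < ‖x‖},
          ENNReal.ofReal ((R / (1 + R)) ^ (-s)) * ENNReal.ofReal ((1 + ‖x‖) ^ (-s)) ∂ν :=
        setLIntegral_mono (by fun_prop) hle
    _ ≤ ∫⁻ x, ENNReal.ofReal ((R / (1 + R)) ^ (-s)) * ENNReal.ofReal ((1 + ‖x‖) ^ (-s)) ∂ν :=
        setLIntegral_le_lintegral _ _
    _ = ENNReal.ofReal ((R / (1 + R)) ^ (-s)) * ∫⁻ x, ENNReal.ofReal ((1 + ‖x‖) ^ (-s)) ∂ν :=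
        lintegral_const_mul _ (by fun_prop)
    _ < ⊤ := ENNReal.mul_lt_top ENNReal.ofReal_lt_top (finite_integral_one_add_norm hs)

/-- Bubbles of concentration at least one have uniformly bounded mass. -/
lemma exists_lintegral_bubble_le (hd : 1 ≤ Module.finrank ℝ E) {a : ℝ}
    (ha : a < Module.finrank ℝ E) (ha' : Module.finrank ℝ E < 2 * a) :
    ∃ M : ENNReal, M < ⊤ ∧ ∀ t : ℝ, 1 ≤ t →
      ∫⁻ y, ENNReal.ofReal (t ^ a * (1 + t ^ 2 * ‖y‖ ^ 2) ^ (-a)) ∂ν ≤ M := by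
  have : Nontrivial E := Module.nontrivial_of_finrank_pos (R := ℝ) hd
  have ha0 : 0 < a := by linarith [(Nat.cast_nonneg (Module.finrank ℝ E) : (0 : ℝ) ≤ _)]
  refine ⟨_, ENNReal.add_lt_top.2 ⟨setLIntegral_ball_norm_rpow_neg_lt_top ν hd ha 2,
    setLIntegral_norm_gt_norm_rpow_neg_lt_top ν one_pos ha'⟩, fun t ht ↦ ?_⟩
  have ht0 : 0 < t := by linarith
  have hcover : Metric.ball (0 : E) 2 ∪ {x : E | 1 < ‖x‖} = Set.univ := by
    ext x
    simp only [Set.mem_union, mem_ball_zero_iff, Set.mem_ofPred_eq, Set.mem_univ, iff_true]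
    by_contra! h
    linarith
  rw [← setLIntegral_univ, ← hcover]
  refine (lintegral_union_le _ _ _).trans (add_le_add ?_ ?_)
  · refine lintegral_mono_ae (ae_restrict_of_ae ?_)
    filter_upwards [Measure.ae_ne ν (0 : E)] with y hy
    exact ENNReal.ofReal_le_ofReal
      (rpow_mul_one_add_sq_rpow_neg_le ha0.le ht0 (norm_pos_iff.2 hy))
  · refine setLIntegral_mono (by fun_prop) fun y (hy : 1 < ‖y‖) ↦ ENNReal.ofReal_le_ofReal ?_
    refine (rpow_mul_one_add_sq_rpow_neg_le_decay ha0.le ht0 (by linarith)).trans ?_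
    exact mul_le_of_le_one_left (by positivity)
      (Real.rpow_le_one_of_one_le_of_nonpos ht (by linarith))

/-- Away from the centre, the Riesz potentials of bubbles of concentration at least one are
uniformly bounded. -/
lemma exists_lintegral_bubble_div_norm_rpow_le (hd : 1 ≤ Module.finrank ℝ E) {a s d : ℝ}
    (ha : a < Module.finrank ℝ E) (ha' : Module.finrank ℝ E < 2 * a) (hs0 : 0 ≤ s)
    (hs : s < Module.finrank ℝ E) (hd0 : 0 < d) :
    ∃ K : ENNReal, K < ⊤ ∧ ∀ t : ℝ, 1 ≤ t → ∀ x : E, 2 * d < ‖x‖ →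
      ∫⁻ y, ENNReal.ofReal (t ^ a * (1 + t ^ 2 * ‖y‖ ^ 2) ^ (-a) / ‖x - y‖ ^ s) ∂ν ≤ K := by
  obtain ⟨M, hM, hMt⟩ := exists_lintegral_bubble_le ν hd ha ha'
  have ha0 : 0 < a := by linarith [(Nat.cast_nonneg (Module.finrank ℝ E) : (0 : ℝ) ≤ _)]
  have hI := setLIntegral_ball_norm_rpow_neg_lt_top ν hd hs d
  rw [← lintegral_indicator measurableSet_ball] at hI
  refine ⟨ENNReal.ofReal (d ^ (-s)) * M + ENNReal.ofReal (d ^ (-(2 * a))) * _,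
    ENNReal.add_lt_top.2 ⟨ENNReal.mul_lt_top ENNReal.ofReal_lt_top hM,
      ENNReal.mul_lt_top ENNReal.ofReal_lt_top hI⟩, fun t ht x hx ↦ ?_⟩
  have ht0 : 0 < t := by linarith
  set g : E → ENNReal :=
    (Metric.ball (0 : E) d).indicator fun z ↦ ENNReal.ofReal (‖z‖ ^ (-s))
  have hgm : Measurable g := Measurable.indicator (by fun_prop) measurableSet_ball
  rw [← lintegral_sub_left_eq_self g x]
  calc _ ≤ ∫⁻ y, (ENNReal.ofReal (d ^ (-s)) *
          ENNReal.ofReal (t ^ a * (1 + t ^ 2 * ‖y‖ ^ 2) ^ (-a)) +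
          ENNReal.ofReal (d ^ (-(2 * a))) * g (x - y)) ∂ν := by
        refine lintegral_mono fun y ↦ ?_
        rw [div_eq_mul_inv, ← Real.rpow_neg (norm_nonneg _)]
        by_cases hy : ‖x - y‖ < d
        · refine le_add_of_nonneg_of_le zero_le ?_
          have hgy : g (x - y) = ENNReal.ofReal (‖x - y‖ ^ (-s)) :=
            Set.indicator_of_mem (mem_ball_zero_iff.2 hy) _
          rw [hgy, ← ENNReal.ofReal_mul (by positivity)]
          have hyd : d ≤ ‖y‖ := by linarith [norm_le_norm_add_norm_sub' x y]
          have h1 := rpow_mul_one_add_sq_rpow_neg_le_decay ha0.le ht0 (hd0.trans_le hyd)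
          have h2 : t ^ (-a) * ‖y‖ ^ (-(2 * a)) ≤ 1 * d ^ (-(2 * a)) :=
            mul_le_mul (Real.rpow_le_one_of_one_le_of_nonpos ht (by linarith))
              (Real.rpow_le_rpow_of_nonpos hd0 hyd (by linarith)) (by positivity) zero_le_one
          have h3 := h1.trans (h2.trans_eq (one_mul _))
          gcongr
        · refine le_add_of_le_of_nonneg ?_ zero_le
          rw [← ENNReal.ofReal_mul (by positivity), mul_comm]
          have h1 : ‖x - y‖ ^ (-s) ≤ d ^ (-s) :=
            Real.rpow_le_rpow_of_nonpos hd0 (not_lt.1 hy) (by linarith)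
          gcongr
    _ ≤ _ := by
        rw [lintegral_add_left (by fun_prop), lintegral_const_mul _ (by fun_prop),
          lintegral_const_mul (f := fun y ↦ g (x - y)) _
            (hgm.comp (measurable_const.sub measurable_id))]
        gcongr
        exact hMt t ht

end

/-- Error estimate R₁ in the proof of Lemma 3.4. -/
theorem error_estimate_R1 (n : ℕ) (hn : 3 ≤ n) (μ : ℝ) (hμ0 : 0 < μ) (hμn : μ < n)
    (ρ : ℝ) (hρ : 0 < ρ) :
    ∃ C : ℝ, 0 < C ∧ ∀ lam : ℝ, 1 ≤ lam → 1 ≤ lam * ρ →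
      ∫⁻ x in {x : EuclideanSpace ℝ (Fin n) | ρ / 2 < ‖x‖},
          ∫⁻ y : EuclideanSpace ℝ (Fin n),
            ENNReal.ofReal
              (lam ^ ((2 * n - μ) / 2) * (1 + lam ^ 2 * ‖y‖ ^ 2) ^ (-((2 * n - μ) / 2)) *
                (lam ^ ((2 * n - μ) / 2) * (1 + lam ^ 2 * ‖x‖ ^ 2) ^ (-((2 * n - μ) / 2))) /
                ‖x - y‖ ^ μ) ≤
        ENNReal.ofReal (C * lam ^ (-((2 * n - μ) / 2))) := by
  have hfin : Module.finrank ℝ (EuclideanSpace ℝ (Fin n)) = n := finrank_euclideanSpace_fin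
  set a : ℝ := (2 * n - μ) / 2 with ha_def
  have ha0 : 0 < a := by rw [ha_def]; linarith
  have ha : a < Module.finrank ℝ (EuclideanSpace ℝ (Fin n)) := by rw [hfin]; linarith
  have ha' : Module.finrank ℝ (EuclideanSpace ℝ (Fin n)) < 2 * a := by rw [hfin]; linarith
  obtain ⟨K, hK, hKt⟩ := exists_lintegral_bubble_div_norm_rpow_le
    (volume : Measure (EuclideanSpace ℝ (Fin n))) (s := μ) (d := ρ / 4) (by omega) ha ha' hμ0.le
    (by rwa [hfin]) (by positivity)
  have hM := setLIntegral_norm_gt_norm_rpow_neg_lt_top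
    (volume : Measure (EuclideanSpace ℝ (Fin n))) (R := ρ / 2) (by positivity) ha'
  set M := ∫⁻ x in {x : EuclideanSpace ℝ (Fin n) | ρ / 2 < ‖x‖},
    ENNReal.ofReal (‖x‖ ^ (-(2 * a)))
  refine ⟨(M * K).toReal + 1, by positivity, fun lam hlam _ ↦ ?_⟩
  have hlam0 : 0 < lam := by linarith
  calc _ ≤ ∫⁻ x in {x : EuclideanSpace ℝ (Fin n) | ρ / 2 < ‖x‖},
          ENNReal.ofReal (‖x‖ ^ (-(2 * a))) * (ENNReal.ofReal (lam ^ (-a)) * K) := by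
        refine setLIntegral_mono (by fun_prop) fun x (hx : ρ / 2 < ‖x‖) ↦ ?_
        have hx0 : 0 < ‖x‖ := by linarith
        have hxb : 0 ≤ lam ^ a * (1 + lam ^ 2 * ‖x‖ ^ 2) ^ (-a) := by positivity
        simp_rw [mul_comm _ (lam ^ a * (1 + lam ^ 2 * ‖x‖ ^ 2) ^ (-a)), mul_div_assoc,
          ENNReal.ofReal_mul hxb]
        rw [lintegral_const_mul _ (by fun_prop), ← mul_assoc,
          ← ENNReal.ofReal_mul (by positivity), mul_comm (‖x‖ ^ _)]
        simp_rw [← mul_div_assoc]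
        refine mul_le_mul' (ENNReal.ofReal_le_ofReal ?_) ?_
        · exact rpow_mul_one_add_sq_rpow_neg_le_decay ha0.le hlam0 hx0
        · exact hKt lam hlam x (by linarith)
    _ = M * K * ENNReal.ofReal (lam ^ (-a)) := by
        rw [lintegral_mul_const _ (by fun_prop)]
        ring
    _ ≤ _ := by
        rw [ENNReal.ofReal_mul (by positivity)]
        gcongr
        rw [← ENNReal.ofReal_toReal (ENNReal.mul_lt_top hM hK).ne]
        exact ENNReal.ofReal_le_ofReal (by simp)
end

section
/- Let n ≥ 3 be an integer and let β be a real number with 1 < β < n − 1. Then the function y ↦ |y₁|^β (‖y‖² − 1)(1 + ‖y‖²)^{−n} is integrable on ℝ^{n−1} and ∫_{ℝ^{n−1}} |y₁|^β (‖y‖² − 1)(1 + ‖y‖²)^{−n} dy > 0. -/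
open MeasureTheory

lemma integrable_abs_coord_rpow_mul_one_div_pow {d : ℕ} (i : Fin d) {β : ℝ} (hβ0 : 0 < β)
    (hβ : β < d) :
    Integrable (fun y : EuclideanSpace ℝ (Fin d) => |y i| ^ β * (1 / (1 + ‖y‖ ^ 2)) ^ d) := by
  have hdom : Integrable
      (fun y : EuclideanSpace ℝ (Fin d) => (1 + ‖y‖ ^ 2) ^ (-(2 * (d : ℝ) - β) / 2)) := by
    apply integrable_rpow_neg_one_add_norm_sq
    rw [finrank_euclideanSpace_fin]
    linarith
  have hcont : Continuous
      (fun y : EuclideanSpace ℝ (Fin d) => |y i| ^ β * (1 / (1 + ‖y‖ ^ 2)) ^ d) := by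
    refine Continuous.mul (Continuous.rpow_const (by fun_prop) fun _ => Or.inr hβ0.le) ?_
    exact (continuous_const.div (by fun_prop) fun y => by positivity).pow d
  refine hdom.mono' hcont.aestronglyMeasurable (.of_forall fun y => ?_)
  have hs : 0 < 1 + ‖y‖ ^ 2 := by positivity
  have hcoord : |y i| ≤ (1 + ‖y‖ ^ 2) ^ (1 / 2 : ℝ) := by
    rw [← Real.sqrt_eq_rpow]
    refine Real.le_sqrt_of_sq_le ?_
    have h := PiLp.norm_apply_le y i
    rw [Real.norm_eq_abs] at h
    nlinarith [abs_nonneg (y i)]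
  have hpow : |y i| ^ β ≤ (1 + ‖y‖ ^ 2) ^ (β / 2) := by
    calc |y i| ^ β ≤ ((1 + ‖y‖ ^ 2) ^ (1 / 2 : ℝ)) ^ β :=
          Real.rpow_le_rpow (abs_nonneg _) hcoord hβ0.le
      _ = (1 + ‖y‖ ^ 2) ^ (β / 2) := by rw [← Real.rpow_mul hs.le]; ring_nf
  rw [Real.norm_of_nonneg (by positivity)]
  calc |y i| ^ β * (1 / (1 + ‖y‖ ^ 2)) ^ d
      ≤ (1 + ‖y‖ ^ 2) ^ (β / 2) * (1 / (1 + ‖y‖ ^ 2)) ^ d := by gcongr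
    _ = (1 + ‖y‖ ^ 2) ^ (-(2 * (d : ℝ) - β) / 2) := by
      rw [one_div, inv_pow, ← Real.rpow_natCast _ d, ← Real.rpow_neg hs.le, ← Real.rpow_add hs]
      ring_nf

lemma integral_abs_coord_rpow_mul_div_pow {d : ℕ} (i : Fin d) (β : ℝ) {t : ℝ} (ht : 0 < t) :
    ∫ y : EuclideanSpace ℝ (Fin d), |y i| ^ β * (t / (t ^ 2 + ‖y‖ ^ 2)) ^ d =
      t ^ β * ∫ y : EuclideanSpace ℝ (Fin d), |y i| ^ β * (1 / (1 + ‖y‖ ^ 2)) ^ d := by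
  have h := Measure.integral_comp_smul (volume : Measure (EuclideanSpace ℝ (Fin d)))
    (fun y => |y i| ^ β * (t / (t ^ 2 + ‖y‖ ^ 2)) ^ d) t
  have hscale (y : EuclideanSpace ℝ (Fin d)) :
      |(t • y) i| ^ β * (t / (t ^ 2 + ‖t • y‖ ^ 2)) ^ d =
        (t ^ β * (t ^ d)⁻¹) * (|y i| ^ β * (1 / (1 + ‖y‖ ^ 2)) ^ d) := by
    have hs : 0 < 1 + ‖y‖ ^ 2 := by positivity
    have hfrac : t / (t ^ 2 + ‖t • y‖ ^ 2) = t⁻¹ * (1 / (1 + ‖y‖ ^ 2)) := by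
      rw [norm_smul, Real.norm_of_nonneg ht.le]
      have : t ^ 2 + (t * ‖y‖) ^ 2 = t ^ 2 * (1 + ‖y‖ ^ 2) := by ring
      rw [this]
      field_simp
    rw [hfrac, PiLp.smul_apply, smul_eq_mul, abs_mul, abs_of_pos ht,
      Real.mul_rpow ht.le (abs_nonneg _), mul_pow, inv_pow]
    ring
  simp only [hscale, integral_const_mul, finrank_euclideanSpace_fin, smul_eq_mul] at h
  rw [abs_of_pos (by positivity)] at h
  have htd : (t ^ d)⁻¹ ≠ 0 := by positivity
  apply mul_left_cancel₀ htd
  rw [← h]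
  ring

lemma hasDerivAt_div_sq_add_pow (d : ℕ) {s t : ℝ} (hs : 0 ≤ s) (ht : 0 < t) :
    HasDerivAt (fun t : ℝ => (t / (t ^ 2 + s)) ^ d)
      (d * (t / (t ^ 2 + s)) ^ (d - 1) * ((s - t ^ 2) / (t ^ 2 + s) ^ 2)) t := by
  have hne : t ^ 2 + s ≠ 0 := by positivity
  have h := (((hasDerivAt_id t).div (((hasDerivAt_id t).pow 2).add_const s) hne).pow d)
  refine HasDerivAt.congr_deriv h ?_
  simp only [id, Pi.pow_apply, Pi.div_apply]
  congr 2
  push_cast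
  ring

lemma abs_deriv_div_sq_add_pow_le {d : ℕ} (hd : d ≠ 0) {s t : ℝ} (hs : 0 ≤ s)
    (ht : t ∈ Metric.ball (1 : ℝ) (1 / 2)) :
    |d * (t / (t ^ 2 + s)) ^ (d - 1) * ((s - t ^ 2) / (t ^ 2 + s) ^ 2)| ≤
      d * 6 ^ d * (1 / (1 + s)) ^ d := by
  rw [Metric.mem_ball, Real.dist_eq, abs_lt] at ht
  have ht0 : 1 / 2 < t := by linarith
  have ht1 : t < 3 / 2 := by linarith
  have hpos : 0 < t ^ 2 + s := by positivity
  have h1 : t / (t ^ 2 + s) ≤ 6 * (1 / (1 + s)) := by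
    rw [mul_one_div, div_le_div_iff₀ hpos (by positivity)]
    nlinarith
  have h2 : |(s - t ^ 2) / (t ^ 2 + s) ^ 2| ≤ 6 * (1 / (1 + s)) := by
    have h3 : |s - t ^ 2| ≤ t ^ 2 + s := by
      rw [abs_le]; constructor <;> nlinarith
    rw [abs_div, abs_of_pos (pow_pos hpos 2), mul_one_div,
      div_le_div_iff₀ (by positivity) (by positivity)]
    calc |s - t ^ 2| * (1 + s) ≤ (t ^ 2 + s) * (6 * (t ^ 2 + s)) := by
          gcongr; nlinarith
      _ = 6 * (t ^ 2 + s) ^ 2 := by ring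
  have h0 : 0 ≤ t / (t ^ 2 + s) := by positivity
  rw [abs_mul, abs_of_nonneg (by positivity : 0 ≤ (d : ℝ) * (t / (t ^ 2 + s)) ^ (d - 1))]
  calc d * (t / (t ^ 2 + s)) ^ (d - 1) * |(s - t ^ 2) / (t ^ 2 + s) ^ 2|
      ≤ d * (6 * (1 / (1 + s))) ^ (d - 1) * (6 * (1 / (1 + s))) := by gcongr
    _ = d * 6 ^ d * (1 / (1 + s)) ^ d := by
      rw [mul_assoc, pow_sub_one_mul hd, mul_pow, mul_assoc]

/-- Differentiating at `t = 1` the scaling identity for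
`∫ |y i| ^ β * (t / (t ^ 2 + ‖y‖ ^ 2)) ^ d`. -/
lemma integrable_and_integral_abs_coord_rpow_mul_deriv {d : ℕ} (i : Fin d) {β : ℝ}
    (hβ0 : 0 < β) (hβ : β < d) :
    Integrable (fun y : EuclideanSpace ℝ (Fin d) => |y i| ^ β *
        (d * (1 / (1 ^ 2 + ‖y‖ ^ 2)) ^ (d - 1) *
          ((‖y‖ ^ 2 - 1 ^ 2) / (1 ^ 2 + ‖y‖ ^ 2) ^ 2))) ∧
      ∫ y : EuclideanSpace ℝ (Fin d), |y i| ^ β *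
        (d * (1 / (1 ^ 2 + ‖y‖ ^ 2)) ^ (d - 1) *
          ((‖y‖ ^ 2 - 1 ^ 2) / (1 ^ 2 + ‖y‖ ^ 2) ^ 2)) =
      β * ∫ y : EuclideanSpace ℝ (Fin d), |y i| ^ β * (1 / (1 + ‖y‖ ^ 2)) ^ d := by
  have hd : d ≠ 0 := i.pos.ne'
  have hintegrable := integrable_abs_coord_rpow_mul_one_div_pow i hβ0 hβ
  have hderiv := hasDerivAt_integral_of_dominated_loc_of_deriv_le
    (μ := (volume : Measure (EuclideanSpace ℝ (Fin d))))
    (F := fun t y => |y i| ^ β * (t / (t ^ 2 + ‖y‖ ^ 2)) ^ d)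
    (F' := fun t y => |y i| ^ β *
      (d * (t / (t ^ 2 + ‖y‖ ^ 2)) ^ (d - 1) * ((‖y‖ ^ 2 - t ^ 2) / (t ^ 2 + ‖y‖ ^ 2) ^ 2)))
    (bound := fun y => d * 6 ^ d * (|y i| ^ β * (1 / (1 + ‖y‖ ^ 2)) ^ d))
    (x₀ := (1 : ℝ)) (s := Metric.ball 1 (1 / 2)) (Metric.ball_mem_nhds _ (by norm_num))
    (.of_forall fun t => Measurable.aestronglyMeasurable (by fun_prop))
    (by simpa only [one_pow] using hintegrable)
    (Measurable.aestronglyMeasurable (by fun_prop))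
    (.of_forall fun y t ht => by
      rw [norm_mul, Real.norm_of_nonneg (by positivity : 0 ≤ |y i| ^ β), Real.norm_eq_abs]
      calc _ ≤ |y i| ^ β * (d * 6 ^ d * (1 / (1 + ‖y‖ ^ 2)) ^ d) := by
            gcongr
            exact abs_deriv_div_sq_add_pow_le hd (sq_nonneg _) ht
        _ = _ := by ring)
    (hintegrable.const_mul _)
    (.of_forall fun y t ht => by
      rw [Metric.mem_ball, Real.dist_eq, abs_lt] at ht
      exact (hasDerivAt_div_sq_add_pow d (sq_nonneg _) (by linarith)).const_mul _)
  refine ⟨hderiv.1, hderiv.2.unique ?_⟩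
  have hpow := (Real.hasDerivAt_rpow_const (x := 1) (p := β) (Or.inl one_ne_zero)).mul_const
    (∫ y : EuclideanSpace ℝ (Fin d), |y i| ^ β * (1 / (1 + ‖y‖ ^ 2)) ^ d)
  rw [Real.one_rpow, mul_one] at hpow
  refine hpow.congr_of_eventuallyEq ?_
  filter_upwards [lt_mem_nhds one_pos] with t ht
  exact integral_abs_coord_rpow_mul_div_pow i β ht

lemma integral_abs_coord_rpow_mul_one_div_pow_pos {d : ℕ} (i : Fin d) {β : ℝ} (hβ0 : 0 < β)
    (hβ : β < d) :
    0 < ∫ y : EuclideanSpace ℝ (Fin d), |y i| ^ β * (1 / (1 + ‖y‖ ^ 2)) ^ d := by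
  refine integral_pos_of_integrable_nonneg_nonzero (x := EuclideanSpace.single i (1 : ℝ)) ?_
    (integrable_abs_coord_rpow_mul_one_div_pow i hβ0 hβ) (fun y => by positivity) ?_
  · refine Continuous.mul (Continuous.rpow_const (by fun_prop) fun _ => Or.inr hβ0.le) ?_
    exact (continuous_const.div (by fun_prop) fun y => by positivity).pow d
  · simp

/-- Positivity of the key integral in the proof of claim (3.32) of Lemma 3.5. -/
theorem key_integral_positive (n : ℕ) (hn : 3 ≤ n) (β : ℝ) (hβ1 : 1 < β)
    (hβ : β < (n : ℝ) - 1) :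
    Integrable (fun y : EuclideanSpace ℝ (Fin (n - 1)) =>
        |y ⟨0, by omega⟩| ^ β * (‖y‖ ^ 2 - 1) * (1 + ‖y‖ ^ 2) ^ (-(n : ℝ))) ∧
      0 < ∫ y : EuclideanSpace ℝ (Fin (n - 1)),
        |y ⟨0, by omega⟩| ^ β * (‖y‖ ^ 2 - 1) * (1 + ‖y‖ ^ 2) ^ (-(n : ℝ)) := by
  have hβ0 : 0 < β := by linarith
  obtain ⟨d, rfl⟩ : ∃ d, n = d + 2 := ⟨n - 2, by omega⟩
  have hβd : β < ((d + 2 - 1 : ℕ) : ℝ) := by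
    rw [Nat.cast_sub (by omega), Nat.cast_one]
    exact hβ
  let i : Fin (d + 2 - 1) := ⟨0, by omega⟩
  have hd : ((d + 2 - 1 : ℕ) : ℝ) ≠ 0 := (hβ0.trans hβd).ne'
  obtain ⟨hintegrable, heq⟩ := integrable_and_integral_abs_coord_rpow_mul_deriv i hβ0 hβd
  have hpos := integral_abs_coord_rpow_mul_one_div_pow_pos i hβ0 hβd
  have hfun : (fun y : EuclideanSpace ℝ (Fin (d + 2 - 1)) =>
      |y i| ^ β * (‖y‖ ^ 2 - 1) * (1 + ‖y‖ ^ 2) ^ (-((d + 2 : ℕ) : ℝ))) =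
      fun y => ((d + 2 - 1 : ℕ) : ℝ)⁻¹ * (|y i| ^ β *
        ((d + 2 - 1 : ℕ) * (1 / (1 ^ 2 + ‖y‖ ^ 2)) ^ (d + 2 - 1 - 1) *
          ((‖y‖ ^ 2 - 1 ^ 2) / (1 ^ 2 + ‖y‖ ^ 2) ^ 2))) := by
    funext y
    have hs : 0 < 1 + ‖y‖ ^ 2 := by positivity
    rw [Real.rpow_neg hs.le, Real.rpow_natCast, show d + 2 - 1 - 1 = d by omega, one_pow,
      one_div, inv_pow, pow_add]
    field_simp
  change Integrable (fun y : EuclideanSpace ℝ (Fin (d + 2 - 1)) =>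
      |y i| ^ β * (‖y‖ ^ 2 - 1) * (1 + ‖y‖ ^ 2) ^ (-((d + 2 : ℕ) : ℝ))) ∧
    0 < ∫ y : EuclideanSpace ℝ (Fin (d + 2 - 1)),
      |y i| ^ β * (‖y‖ ^ 2 - 1) * (1 + ‖y‖ ^ 2) ^ (-((d + 2 : ℕ) : ℝ))
  rw [hfun, integral_const_mul, heq]
  exact ⟨hintegrable.const_mul _, mul_pos (inv_pos.2 (hβ0.trans hβd)) (mul_pos hβ0 hpos)⟩
end

section
/- Let n ≥ 3 be an integer, let μ be a real number with 0 < μ ≤ 4 and μ < n, and let β be a real number with 1 < β < n − 1. Set 2^*_μ = (2n − μ)/(n − 2), c₁ = ∫_{ℝ^{n−1}} |z₁|^β (1 + ‖z‖²)^{−(n−1)} dz and c₂ = ∫_{ℝ^{n−1}} |z₁|^β (1 + ‖z‖²)^{−n} dz. Then (n − 2) c₁ − (n − 2 + (2/2^*_μ) n) c₂ > 0; equivalently, (n−2) c₁ > (n − 2 + 2n(n−2)/(2n−μ)) c₂. -/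
open MeasureTheory

/-- Tangent-line inequality for the convex function `x ↦ x ^ (-p)`. -/
lemma rpow_neg_tangent_le {p x y : ℝ} (hp : 0 ≤ p) (hx : 0 < x) (hy : 0 < y) :
    x ^ (-p) - p * (y - x) * x ^ (-(p + 1)) ≤ y ^ (-p) := by
  have h1 : 1 - p * (y / x - 1) ≤ (y / x) ^ (-p) := by
    rw [Real.rpow_def_of_pos (div_pos hy hx)]
    have h2 := Real.add_one_le_exp (Real.log (y / x) * -p)
    have h3 := Real.log_le_sub_one_of_pos (div_pos hy hx)
    nlinarith [mul_le_mul_of_nonneg_left h3 hp]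
  have hxp : 0 < x ^ (-p) := Real.rpow_pos_of_pos hx _
  have h4 : (y / x) ^ (-p) * x ^ (-p) = y ^ (-p) := by
    rw [← Real.mul_rpow (div_pos hy hx).le hx.le, div_mul_cancel₀ _ hx.ne']
  have h5 : x ^ (-(p + 1)) = x ^ (-p) / x := by
    rw [neg_add, ← sub_eq_add_neg, Real.rpow_sub_one hx.ne']
  rw [← h4, h5]
  calc x ^ (-p) - p * (y - x) * (x ^ (-p) / x) = (1 - p * (y / x - 1)) * x ^ (-p) := by
        field_simp
    _ ≤ _ := mul_le_mul_of_nonneg_right h1 hxp.le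

section

variable {d : ℕ} (i : Fin d) {β p : ℝ}

lemma continuous_abs_coord_rpow_mul (hβ : 0 ≤ β) :
    Continuous fun z : EuclideanSpace ℝ (Fin d) => |z i| ^ β * (1 + ‖z‖ ^ 2) ^ (-p) := by
  refine Continuous.mul ?_ ?_
  · exact Continuous.rpow_const (by fun_prop) fun _ => Or.inr hβ
  · exact Continuous.rpow_const (by fun_prop) fun z => Or.inl (by positivity)

lemma integrable_abs_coord_rpow_mul (hβ : 0 ≤ β) (hp : d + β < 2 * p) :
    Integrable fun z : EuclideanSpace ℝ (Fin d) => |z i| ^ β * (1 + ‖z‖ ^ 2) ^ (-p) := by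
  have h := integrable_rpow_neg_one_add_norm_sq (E := EuclideanSpace ℝ (Fin d)) (μ := volume)
    (r := 2 * p - β) (by simp; linarith)
  refine h.mono' (continuous_abs_coord_rpow_mul i hβ).aestronglyMeasurable (.of_forall fun z => ?_)
  have h1 : (0 : ℝ) < 1 + ‖z‖ ^ 2 := by positivity
  rw [Real.norm_of_nonneg (by positivity),
    show -(2 * p - β) / 2 = β / 2 + -p by ring, Real.rpow_add h1]
  gcongr
  have h2 : |z i| ≤ (1 + ‖z‖ ^ 2) ^ (1 / 2 : ℝ) := by
    rw [← Real.sqrt_eq_rpow]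
    refine Real.le_sqrt_of_sq_le ?_
    have := PiLp.norm_apply_le z i
    rw [Real.norm_eq_abs] at this
    nlinarith [abs_nonneg (z i)]
  calc |z i| ^ β ≤ ((1 + ‖z‖ ^ 2) ^ (1 / 2 : ℝ)) ^ β := by gcongr
    _ = _ := by rw [← Real.rpow_mul h1.le]; ring_nf

lemma integral_abs_coord_rpow_mul_pos (hβ : 0 ≤ β) (hp : d + β < 2 * p) :
    0 < ∫ z : EuclideanSpace ℝ (Fin d), |z i| ^ β * (1 + ‖z‖ ^ 2) ^ (-p) := by
  refine integral_pos_of_integrable_nonneg_nonzero (x := EuclideanSpace.single i 1)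
    (continuous_abs_coord_rpow_mul i hβ) (integrable_abs_coord_rpow_mul i hβ hp)
    (fun z => by positivity) ?_
  simp only [PiLp.single_apply, if_true, abs_one, Real.one_rpow, one_mul]
  positivity

lemma integral_abs_coord_rpow_mul_scaled {R : ℝ} (hR : 0 < R) :
    ∫ z : EuclideanSpace ℝ (Fin d), |z i| ^ β * (1 + R ^ 2 * ‖z‖ ^ 2) ^ (-p) =
      R ^ (-(β + d)) * ∫ z : EuclideanSpace ℝ (Fin d), |z i| ^ β * (1 + ‖z‖ ^ 2) ^ (-p) := by
  have h := Measure.integral_comp_smul (volume : Measure (EuclideanSpace ℝ (Fin d)))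
    (fun z => |z i| ^ β * (1 + ‖z‖ ^ 2) ^ (-p)) R
  have h1 : ∀ z : EuclideanSpace ℝ (Fin d),
      |(R • z) i| ^ β * (1 + ‖R • z‖ ^ 2) ^ (-p) =
        R ^ β * (|z i| ^ β * (1 + R ^ 2 * ‖z‖ ^ 2) ^ (-p)) := by
    intro z
    rw [norm_smul, PiLp.smul_apply, smul_eq_mul, abs_mul, Real.norm_eq_abs, abs_of_pos hR,
      Real.mul_rpow hR.le (abs_nonneg _), mul_pow, mul_assoc]
  simp only [h1, integral_const_mul, finrank_euclideanSpace_fin, smul_eq_mul] at h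
  rw [abs_of_pos (by positivity)] at h
  rw [neg_add, Real.rpow_add hR, Real.rpow_neg hR.le, Real.rpow_neg hR.le, Real.rpow_natCast,
    mul_assoc, ← h, inv_mul_cancel_left₀ (by positivity)]

/-- Recursion in the exponent `p`, obtained by varying the dilation parameter. -/
lemma integral_abs_coord_rpow_mul_succ (hβ : 0 ≤ β) (hp : d + β < 2 * p) :
    2 * p * ∫ z : EuclideanSpace ℝ (Fin d), |z i| ^ β * (1 + ‖z‖ ^ 2) ^ (-(p + 1)) =
      (2 * p - d - β) *
        ∫ z : EuclideanSpace ℝ (Fin d), |z i| ^ β * (1 + ‖z‖ ^ 2) ^ (-p) := by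
  have hp0 : 0 ≤ p := by have : (0 : ℝ) ≤ d := d.cast_nonneg; linarith
  have i1 := integrable_abs_coord_rpow_mul i hβ hp
  have i2 := integrable_abs_coord_rpow_mul i (p := p + 1) hβ (by linarith)
  have hsc := fun R : ℝ => integral_abs_coord_rpow_mul_scaled i (β := β) (p := p) (R := R)
  set c₁ := ∫ z : EuclideanSpace ℝ (Fin d), |z i| ^ β * (1 + ‖z‖ ^ 2) ^ (-p) with hc₁
  set c₂ := ∫ z : EuclideanSpace ℝ (Fin d), |z i| ^ β * (1 + ‖z‖ ^ 2) ^ (-(p + 1)) with hc₂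
  have key : ∀ R : ℝ, 0 < R →
      c₁ ≤ R ^ (-(β + d)) * c₁ + p * (R ^ 2 - 1) * (c₁ - c₂) := by
    intro R hR
    have i3 : Integrable fun z : EuclideanSpace ℝ (Fin d) =>
        |z i| ^ β * (1 + R ^ 2 * ‖z‖ ^ 2) ^ (-p) := by
      have h := (i1.comp_smul hR.ne').const_mul (R ^ (-β))
      refine h.congr (.of_forall fun z => ?_)
      simp only [norm_smul, PiLp.smul_apply, smul_eq_mul, abs_mul, Real.norm_eq_abs,
        abs_of_pos hR, Real.mul_rpow hR.le (abs_nonneg (z i)), mul_pow]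
      rw [Real.rpow_neg hR.le, mul_assoc, inv_mul_cancel_left₀ (by positivity)]
    have hle : ∀ z : EuclideanSpace ℝ (Fin d),
        |z i| ^ β * (1 + ‖z‖ ^ 2) ^ (-p) -
          p * (R ^ 2 - 1) * (|z i| ^ β * (1 + ‖z‖ ^ 2) ^ (-p) -
            |z i| ^ β * (1 + ‖z‖ ^ 2) ^ (-(p + 1))) ≤
          |z i| ^ β * (1 + R ^ 2 * ‖z‖ ^ 2) ^ (-p) := by
      intro z
      have hx : (0 : ℝ) < 1 + ‖z‖ ^ 2 := by positivity
      have ht := rpow_neg_tangent_le hp0 hx (y := 1 + R ^ 2 * ‖z‖ ^ 2) (by positivity)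
      have hs : (1 + ‖z‖ ^ 2) ^ (-p) = (1 + ‖z‖ ^ 2) * (1 + ‖z‖ ^ 2) ^ (-(p + 1)) := by
        rw [show -p = 1 + -(p + 1) by ring, Real.rpow_add hx, Real.rpow_one]
      refine le_trans (le_of_eq ?_)
        (mul_le_mul_of_nonneg_left ht (Real.rpow_nonneg (abs_nonneg (z i)) β))
      rw [hs]
      ring
    have i4 : Integrable fun z : EuclideanSpace ℝ (Fin d) =>
        p * (R ^ 2 - 1) * (|z i| ^ β * (1 + ‖z‖ ^ 2) ^ (-p) -
          |z i| ^ β * (1 + ‖z‖ ^ 2) ^ (-(p + 1))) := (i1.sub i2).const_mul _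
    have h := integral_mono (i1.sub i4) i3 hle
    simp only [Pi.sub_apply] at h
    rw [integral_sub i1 i4, integral_const_mul, integral_sub i1 i2, hsc R hR,
      ← hc₁, ← hc₂] at h
    linarith
  have hmin : IsLocalMin
      (fun R : ℝ => R ^ (-(β + d)) * c₁ + p * (R ^ 2 - 1) * (c₁ - c₂)) 1 := by
    filter_upwards [lt_mem_nhds (zero_lt_one' ℝ)] with R hR
    simpa using key R hR
  have hd : HasDerivAt (fun R : ℝ => R ^ (-(β + d)) * c₁ + p * (R ^ 2 - 1) * (c₁ - c₂))
      (-(β + d) * c₁ + p * 2 * (c₁ - c₂)) 1 := by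
    have h1 := (Real.hasDerivAt_rpow_const (x := 1) (p := -(β + d)) (Or.inl one_ne_zero)).mul_const c₁
    have h2 := ((((hasDerivAt_id (1 : ℝ)).pow 2).sub_const 1).const_mul p).mul_const (c₁ - c₂)
    refine (h1.add h2).congr_deriv ?_
    simp
  linarith [hmin.hasDerivAt_eq_zero hd]

end

/-- Claim (3.32) in the proof of Lemma 3.5: the constant
`c̄ = (n-2)c₁ - (n-2 + (2/2^*_μ)n)c₂` is positive. -/
theorem cbar_positive (n : ℕ) (hn : 3 ≤ n) (μ : ℝ) (hμ0 : 0 < μ) (hμ4 : μ ≤ 4)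
    (hμn : μ < n) (β : ℝ) (hβ1 : 1 < β) (hβ : β < (n : ℝ) - 1) :
    0 < ((n : ℝ) - 2) *
          (∫ z : EuclideanSpace ℝ (Fin (n - 1)),
            |z ⟨0, by omega⟩| ^ β * (1 + ‖z‖ ^ 2) ^ (-((n : ℝ) - 1))) -
        ((n : ℝ) - 2 + 2 / ((2 * n - μ) / ((n : ℝ) - 2)) * n) *
          ∫ z : EuclideanSpace ℝ (Fin (n - 1)),
            |z ⟨0, by omega⟩| ^ β * (1 + ‖z‖ ^ 2) ^ (-(n : ℝ)) := by
  have hn3 : (3 : ℝ) ≤ n := by exact_mod_cast hn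
  have hcast : ((n - 1 : ℕ) : ℝ) = n - 1 := by rw [Nat.cast_sub (by omega), Nat.cast_one]
  have hβ0 : 0 ≤ β := by linarith
  have hp : ((n - 1 : ℕ) : ℝ) + β < 2 * ((n : ℝ) - 1) := by rw [hcast]; linarith
  have hpos := integral_abs_coord_rpow_mul_pos (⟨0, by omega⟩ : Fin (n - 1)) hβ0 hp
  have hrec := integral_abs_coord_rpow_mul_succ (⟨0, by omega⟩ : Fin (n - 1)) hβ0 hp
  rw [hcast, sub_add_cancel] at hrec
  set c₁ := ∫ z : EuclideanSpace ℝ (Fin (n - 1)),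
    |z ⟨0, by omega⟩| ^ β * (1 + ‖z‖ ^ 2) ^ (-((n : ℝ) - 1))
  set c₂ := ∫ z : EuclideanSpace ℝ (Fin (n - 1)),
    |z ⟨0, by omega⟩| ^ β * (1 + ‖z‖ ^ 2) ^ (-(n : ℝ))
  have hD : 0 < 2 * (n : ℝ) - μ := by linarith
  have hc₂ : c₂ < ((n : ℝ) - 2) / (2 * (n - 1)) * c₁ := by
    rw [div_mul_eq_mul_div, lt_div_iff₀ (by linarith)]
    nlinarith
  have hc₂0 : 0 < (n : ℝ) - 2 := by linarith
  have hK : (n : ℝ) - 2 + 2 / ((2 * n - μ) / ((n : ℝ) - 2)) * n ≤ 2 * (n - 1) := by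
    have : 2 / ((2 * n - μ) / ((n : ℝ) - 2)) ≤ 1 := by
      rw [div_le_one (by positivity), le_div_iff₀ hc₂0]
      linarith
    nlinarith
  have hK0 : 0 < (n : ℝ) - 2 + 2 / ((2 * n - μ) / ((n : ℝ) - 2)) * n := by positivity
  have h1 := mul_lt_mul_of_pos_left hc₂ hK0
  have h2 : 0 ≤ ((n : ℝ) - 2) / (2 * (n - 1)) * c₁ :=
    mul_nonneg (div_nonneg hc₂0.le (by linarith)) hpos.le
  have h3 := mul_le_mul_of_nonneg_right hK h2
  have h4 : 2 * ((n : ℝ) - 1) * (((n : ℝ) - 2) / (2 * (n - 1)) * c₁) = (n - 2) * c₁ := by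
    have : (n : ℝ) - 1 ≠ 0 := by linarith
    field_simp
  linarith
end
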